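/- Suppose the set {t > T_1 : m(t) < 0} is nonempty and let α := inf{t > T_1 : m(t) < 0}. Then ψ_1(a) → α as a → −∞; that is, for every ε > 0 there exists A ∈ ℝ such that for all a ≤ −A one has a ∈ B_1 and α ≤ ψ_1(a) < α + ε. -/

import Mathlib

open Set

/-- A solution of `(p v')' = g v` with `g ≥ 0` on `(T, t)`, starting from `v T = 1`, `v' T = 0`,
does not vanish at `t`. -/
lemma ne_zero_of_nonneg_potential {p g v : ℝ → ℝ} {T t : ℝ} (hTt : T ≤ t)
    (hp : ∀ s, 0 < p s) (hv : Differentiable ℝ v)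
    (hpv : Differentiable ℝ (fun s => p s * deriv v s))
    (heq : ∀ s, deriv (fun s => p s * deriv v s) s = g s * v s)
    (hg : ∀ s ∈ Ioo T t, 0 ≤ g s) (hvT : v T = 1) (hv'T : deriv v T = 0) :
    v t ≠ 0 := by
  have hflux : MonotoneOn (fun s => p s * deriv v s * v s) (Icc T t) := by
    refine monotoneOn_of_hasDerivWithinAt_nonneg (convex_Icc T t)
      (hpv.mul hv).continuous.continuousOn
      (fun s _ => ((hpv s).hasDerivAt.mul (hv s).hasDerivAt).hasDerivWithinAt) ?_
    intro s hs
    rw [interior_Icc] at hs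
    rw [heq]
    nlinarith [mul_nonneg (hg s hs) (mul_self_nonneg (v s)),
      mul_nonneg (hp s).le (mul_self_nonneg (deriv v s))]
  have hsq : MonotoneOn (fun s => v s * v s) (Icc T t) := by
    refine monotoneOn_of_hasDerivWithinAt_nonneg (convex_Icc T t)
      (hv.mul hv).continuous.continuousOn
      (fun s _ => ((hv s).hasDerivAt.mul (hv s).hasDerivAt).hasDerivWithinAt) ?_
    intro s hs
    rw [interior_Icc] at hs
    have h := hflux (left_mem_Icc.2 hTt) (Ioo_subset_Icc_self hs) hs.1.le
    simp only [hv'T, mul_zero, zero_mul] at h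
    have h' : 0 ≤ deriv v s * v s := by
      rw [mul_assoc] at h
      exact nonneg_of_mul_nonneg_right h (hp s)
    linarith [mul_comm (v s) (deriv v s)]
  intro h0
  have h := hsq (left_mem_Icc.2 hTt) (right_mem_Icc.2 hTt) hTt
  simp only [hvT, h0] at h
  norm_num at h

/-- A solution of `(p v')' = g v` with `g ≤ -L² P` and `0 < p ≤ P` on `[c, d]`, where
`L (d - c) ≥ π`, vanishes somewhere on `[c, d]`. -/
lemma exists_zero_of_potential_le {p g v : ℝ → ℝ} {c d L P : ℝ} (hcd : c ≤ d)
    (hL : 0 < L) (hP : 0 < P) (hLcd : Real.pi ≤ L * (d - c))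
    (hp : ∀ s, 0 < p s) (hpP : ∀ s, p s ≤ P) (hv : Differentiable ℝ v)
    (hpv : Differentiable ℝ (fun s => p s * deriv v s))
    (heq : ∀ s, deriv (fun s => p s * deriv v s) s = g s * v s)
    (hg : ∀ s ∈ Icc c d, g s ≤ -(L ^ 2 * P)) :
    ∃ z ∈ Icc c d, v z = 0 := by
  by_contra! hne
  set r : ℝ → ℝ := fun s => p s * deriv v s / v s with hr
  have hr' : ∀ s ∈ Icc c d, HasDerivAt r (g s - r s ^ 2 / p s) s := by
    intro s hs
    have h := (hpv s).hasDerivAt.div (hv s).hasDerivAt (hne s hs)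
    rw [heq] at h
    refine h.congr_deriv ?_
    have := hne s hs
    have := (hp s).ne'
    simp only [hr]
    field_simp
  have hF : ∀ s ∈ Icc c d, HasDerivAt (fun s => Real.arctan (r s / (L * P)) + L * s)
      (1 / (1 + (r s / (L * P)) ^ 2) * ((g s - r s ^ 2 / p s) / (L * P)) + L * 1) s :=
    fun s hs => (((hr' s hs).div_const _).arctan).add ((hasDerivAt_id s).const_mul L)
  have hanti : AntitoneOn (fun s => Real.arctan (r s / (L * P)) + L * s) (Icc c d) := by
    refine antitoneOn_of_hasDerivWithinAt_nonpos (convex_Icc c d)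
      (fun s hs => (hF s hs).continuousAt.continuousWithinAt)
      (fun s hs => (hF s (interior_subset hs)).hasDerivWithinAt) ?_
    intro s hs
    have hs' := interior_subset hs
    have h1 : r s ^ 2 / P ≤ r s ^ 2 / p s :=
      div_le_div_of_nonneg_left (sq_nonneg _) (hp s) (hpP s)
    have h2 : (g s - r s ^ 2 / p s) / (L * P) ≤ -(L * (1 + (r s / (L * P)) ^ 2)) := by
      rw [div_le_iff₀ (by positivity)]
      have h3 : -(L * (1 + (r s / (L * P)) ^ 2)) * (L * P) = -(L ^ 2 * P) - r s ^ 2 / P := by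
        field_simp
        ring
      linarith [hg s hs']
    have h4 : (0 : ℝ) < 1 + (r s / (L * P)) ^ 2 := by positivity
    have h5 := mul_le_mul_of_nonneg_left h2 (one_div_pos.2 h4).le
    have h6 : 1 / (1 + (r s / (L * P)) ^ 2) * -(L * (1 + (r s / (L * P)) ^ 2)) = -L := by
      field_simp
    linarith
  have h := hanti (left_mem_Icc.2 hcd) (right_mem_Icc.2 hcd) hcd
  simp only at h
  linarith [Real.neg_pi_div_two_lt_arctan (r d / (L * P)),
    Real.arctan_lt_pi_div_two (r c / (L * P))]


/-- Property 4 (ii): if `{t > T₁ : m t < 0}` is nonempty with infimum `α`, then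
`ψ₁(a) → α` as `a → -∞`: for every `ε > 0` there is `A` such that for all `a ≤ -A`,
`a ∈ B₁` and `α ≤ ψ₁(a) < α + ε`. -/
theorem psi1_tendsto_at_bot
    (T₁ p₁ p₂ q₂ : ℝ) (hp₁ : 0 < p₁)
    (p q m : ℝ → ℝ)
    (hpc : Continuous p) (hqc : Continuous q) (hmc : Continuous m)
    (hpb : ∀ t, p₁ ≤ p t) (hpb2 : ∀ t, p t ≤ p₂)
    (hqb : ∀ t, 0 ≤ q t) (hqb2 : ∀ t, q t ≤ q₂)
    (v : ℝ → ℝ → ℝ)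
    (hvdiff : ∀ a, Differentiable ℝ (v a))
    (hpvdiff : ∀ a, Differentiable ℝ (fun t => p t * deriv (v a) t))
    (heq : ∀ a t, -(deriv (fun s => p s * deriv (v a) s) t) + q t * v a t = a * m t * v a t)
    (hvT : ∀ a, v a T₁ = 1) (hv'T : ∀ a, deriv (v a) T₁ = 0)
    (hne : {t : ℝ | T₁ < t ∧ m t < 0}.Nonempty) :
    ∀ ε : ℝ, 0 < ε → ∃ A : ℝ, ∀ a : ℝ, a ≤ -A →
      {t : ℝ | T₁ < t ∧ v a t = 0}.Nonempty ∧
      sInf {t : ℝ | T₁ < t ∧ m t < 0} ≤ sInf {t : ℝ | T₁ < t ∧ v a t = 0} ∧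
      sInf {t : ℝ | T₁ < t ∧ v a t = 0} < sInf {t : ℝ | T₁ < t ∧ m t < 0} + ε := by
  intro ε hε
  have hp : ∀ s, 0 < p s := fun s => hp₁.trans_le (hpb s)
  have hp₂ : 0 < p₂ := (hp T₁).trans_le (hpb2 T₁)
  have hq₂ : 0 ≤ q₂ := (hqb T₁).trans (hqb2 T₁)
  have hode : ∀ a t, deriv (fun s => p s * deriv (v a) s) t = (q t - a * m t) * v a t := by
    intro a t
    linarith [heq a t]
  have hbdd : BddBelow {t : ℝ | T₁ < t ∧ m t < 0} := ⟨T₁, fun t ht => ht.1.le⟩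
  obtain ⟨t₀, ⟨hTt₀, hmt₀⟩, ht₀⟩ := exists_lt_of_csInf_lt hne (lt_add_of_pos_right _ hε)
  have hU : {t : ℝ | m t < m t₀ / 2} ∩ Ioo T₁ (sInf {t : ℝ | T₁ < t ∧ m t < 0} + ε) ∈ nhds t₀ :=
    Filter.inter_mem ((isOpen_lt hmc continuous_const).mem_nhds (show m t₀ < m t₀ / 2 by linarith))
      (Ioo_mem_nhds hTt₀ ht₀)
  obtain ⟨η, hη, hball⟩ := Metric.nhds_basis_closedBall.mem_iff.1 hU
  rw [Real.closedBall_eq_Icc] at hball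
  have hLpos : 0 < Real.pi / (2 * η) := div_pos Real.pi_pos (by linarith)
  set L : ℝ := Real.pi / (2 * η) with hL
  set δ : ℝ := -(m t₀ / 2) with hδ
  have hδ0 : 0 < δ := by linarith
  refine ⟨(q₂ + L ^ 2 * p₂) / δ, fun a ha => ?_⟩
  have ha0 : a ≤ 0 := ha.trans (neg_nonpos.2 (by positivity))
  have haδ : q₂ + L ^ 2 * p₂ ≤ -a * δ := (div_le_iff₀ hδ0).1 (by linarith)
  obtain ⟨z, hz, hz0⟩ := exists_zero_of_potential_le (c := t₀ - η) (d := t₀ + η) (by linarith)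
    hLpos hp₂ (by rw [hL]; field_simp; linarith) hp hpb2 (hvdiff a) (hpvdiff a) (hode a) (by
      intro s hs
      have hm : m s ≤ -δ := by
        have : m s < m t₀ / 2 := (hball hs).1
        linarith
      nlinarith [hqb2 s, mul_le_mul_of_nonneg_left hm (neg_nonneg.2 ha0)])
  have hzI := (hball hz).2
  have hzmem : z ∈ {t : ℝ | T₁ < t ∧ v a t = 0} := ⟨hzI.1, hz0⟩
  refine ⟨⟨z, hzmem⟩, le_csInf ⟨z, hzmem⟩ ?_,
    (csInf_le ⟨T₁, fun t ht => ht.1.le⟩ hzmem).trans_lt hzI.2⟩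
  rintro t ⟨hTt, ht0⟩
  by_contra! hlt
  refine ne_zero_of_nonneg_potential hTt.le hp (hvdiff a) (hpvdiff a) (hode a) ?_ (hvT a)
    (hv'T a) ht0
  intro s hs
  have hms : 0 ≤ m s := by
    by_contra! hms
    linarith [csInf_le hbdd (show s ∈ {t : ℝ | T₁ < t ∧ m t < 0} from ⟨hs.1, hms⟩), hs.2]
  linarith [hqb s, mul_nonneg (neg_nonneg.2 ha0) hms]
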